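/- Let L be a smooth k-th order Lagrangian, let 1 ≤ l ≤ k, let F^λ be smooth functions of jet variables of order ≤ l−1, and let L̃ := L + L₀ where L₀ is the total divergence of the F^λ (so L̃ is again a k-th order Lagrangian). Then a pair (φ, p) of a smooth function φ : ℝ^n → ℝ and smooth momenta p^{μ₁…μ_m λ} satisfies the canonical first-order Euler–Lagrange system of L if and only if the pair (φ, p̃), with shifted momenta p̃^{μ₁…μ_m λ} := p^{μ₁…μ_m λ} + (∂F^λ/∂u_{μ₁…μ_m}) evaluated along the (l−1)-jet of φ for 0 ≤ m ≤ l−1 (and p̃ = p in the remaining ranks), satisfies the canonical first-order Euler–Lagrange system of L̃. -/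

import Mathlib

noncomputable section

open scoped BigOperators

/-- Points of the base `ℝⁿ`. -/
abbrev Vec (n : ℕ) : Type := Fin n → ℝ

/-- The space of jet variables `(u_{μ₁…μ_r})_{0 ≤ r ≤ k}` of order `≤ k`
(arrays indexed by tuples of indices). -/
abbrev JetU (n k : ℕ) : Type := ∀ r : Fin (k + 1), (Fin (r : ℕ) → Fin n) → ℝ

/-- The full variable space `(x^μ; u_{μ₁…μ_r}, 0 ≤ r ≤ k)` of a `k`-th order
Lagrangian. -/
abbrev Jet (n k : ℕ) : Type := Vec n × JetU n k

/-- Iterated partial derivative `∂_{t 0} ⋯ ∂_{t (l-1)} g` at `x`. -/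
def pderivIter (n l : ℕ) (t : Fin l → Fin n) (g : Vec n → ℝ) (x : Vec n) : ℝ :=
  iteratedFDeriv ℝ l g x fun i => Pi.single (t i) 1

/-- Partial derivative `∂_λ g` at `x`. -/
def pderiv1 (n : ℕ) (lam : Fin n) (g : Vec n → ℝ) (x : Vec n) : ℝ :=
  fderiv ℝ g x (Pi.single lam 1)

/-- The `k`-jet of `φ` at `x`: substitute `u_{μ₁…μ_r} = ∂_{μ₁}⋯∂_{μ_r} φ(x)`. -/
def jetEv (n k : ℕ) (φ : Vec n → ℝ) (x : Vec n) : Jet n k :=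
  (x, fun r t => pderivIter n (r : ℕ) t φ x)

/-- The symmetric array `∂L/∂u_{μ₁…μ_r}` (the array characterized by the fact
that its full contraction with a symmetric increment of the rank-`r` jet
variables is the corresponding directional derivative of `L`), evaluated at the
tuple `t` and the point `z`. -/
def dLdu (n k : ℕ) (L : Jet n k → ℝ) (r : Fin (k + 1)) (t : Fin (r : ℕ) → Fin n)
    (z : Jet n k) : ℝ :=
  ((r : ℕ).factorial : ℝ)⁻¹ *
    ∑ σ : Equiv.Perm (Fin (r : ℕ)),
      fderiv ℝ L z (0, Pi.single r (Pi.single (t ∘ σ) 1))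

/-- Total symmetrization `q^{(μ₁…μ_l λ)}` of a momentum array
`q^{μ₁…μ_l λ}`, evaluated at the length-`(l+1)` tuple `s`. -/
def symComb (n l : ℕ) (q : (Fin l → Fin n) → Fin n → ℝ) (s : Fin (l + 1) → Fin n) : ℝ :=
  ((l + 1).factorial : ℝ)⁻¹ *
    ∑ σ : Equiv.Perm (Fin (l + 1)),
      q (fun i => s (σ (Fin.castSucc i))) (s (σ (Fin.last l)))

/-- Momenta `p^{μ₁…μ_l λ}` (`0 ≤ l ≤ k−1`) for a `k`-th order theory:
fields on `ℝⁿ` indexed by a tuple `μ₁…μ_l` and an extra index `λ`. -/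
abbrev Mom (n k : ℕ) : Type := ∀ l : Fin k, (Fin (l : ℕ) → Fin n) → Fin n → Vec n → ℝ

/-- `C^∞` smoothness. -/
def IsCInf {E F : Type*} [NormedAddCommGroup E] [NormedSpace ℝ E]
    [NormedAddCommGroup F] [NormedSpace ℝ F] (f : E → F) : Prop :=
  ∀ m : ℕ, ContDiff ℝ m f

/-- All components of the momenta are smooth. -/
def MomSmooth (n k : ℕ) (p : Mom n k) : Prop :=
  ∀ (l : Fin k) (t : Fin (l : ℕ) → Fin n) (lam : Fin n), IsCInf (p l t lam)

/-- The momenta are symmetric in the indices `μ₁…μ_l`. -/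
def MomSym (n k : ℕ) (p : Mom n k) : Prop :=
  ∀ (l : Fin k) (σ : Equiv.Perm (Fin (l : ℕ))) (t : Fin (l : ℕ) → Fin n)
    (lam : Fin n) (x : Vec n), p l (t ∘ σ) lam x = p l t lam x

/-- The momenta are totally symmetric in all indices `μ₁…μ_l λ`. -/
def MomTotSym (n k : ℕ) (p : Mom n k) : Prop :=
  ∀ (l : Fin k) (σ : Equiv.Perm (Fin ((l : ℕ) + 1))) (s : Fin ((l : ℕ) + 1) → Fin n)
    (x : Vec n),
    p l (fun i => s (σ (Fin.castSucc i))) (s (σ (Fin.last (l : ℕ)))) x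
      = p l (fun i => s (Fin.castSucc i)) (s (Fin.last (l : ℕ))) x

/-- The canonical first-order Euler–Lagrange system of a `(K+1)`-th order
Lagrangian `L` for a pair `(φ, p)`:
`p^{(μ₁…μ_k)} = ∂L/∂u_{μ₁…μ_k}`;
`p^{(μ₁…μ_l)} = ∂L/∂u_{μ₁…μ_l} − Σ_λ ∂_λ p^{μ₁…μ_l λ}` for `1 ≤ l ≤ k−1`;
`0 = ∂L/∂u − Σ_λ ∂_λ p^λ`, all derivatives of `L` being evaluated along the
`k`-jet of `φ` (here `k = K+1`). -/
def CanonSys (n K : ℕ) (L : Jet n (K + 1) → ℝ) (φ : Vec n → ℝ) (p : Mom n (K + 1)) : Prop :=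
  (∀ x : Vec n,
      dLdu n (K + 1) L ⟨0, Nat.succ_pos _⟩ Fin.elim0 (jetEv n (K + 1) φ x)
        - ∑ lam : Fin n, pderiv1 n lam (p ⟨0, Nat.succ_pos _⟩ Fin.elim0 lam) x = 0)
  ∧ (∀ (l : Fin (K + 1)) (s : Fin ((l : ℕ) + 1) → Fin n) (x : Vec n),
      symComb n (l : ℕ) (fun t lam => p l t lam x) s
        = dLdu n (K + 1) L ⟨(l : ℕ) + 1, Nat.succ_lt_succ l.isLt⟩ s (jetEv n (K + 1) φ x)
          - if h : (l : ℕ) + 1 < K + 1 then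
              ∑ lam : Fin n, pderiv1 n lam (p ⟨(l : ℕ) + 1, h⟩ s lam) x
            else 0)

/-- The Euler–Lagrange equation of order `2k` (`k = K+1`) of `L` for `φ`:
`Σ_{r=0}^{k} (−1)^r Σ_{μ₁…μ_r} ∂_{μ₁}⋯∂_{μ_r}[∂L/∂u_{μ₁…μ_r} ∘ (k-jet of φ)] = 0`. -/
def ELeq (n K : ℕ) (L : Jet n (K + 1) → ℝ) (φ : Vec n → ℝ) : Prop :=
  ∀ x : Vec n,
    ∑ r : Fin (K + 2),
      ((-1 : ℝ) ^ (r : ℕ)) *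
        ∑ t : Fin (r : ℕ) → Fin n,
          pderivIter n (r : ℕ) t
            (fun y => dLdu n (K + 1) L r t (jetEv n (K + 1) φ y)) x
      = 0
/-- Truncation of a jet of order `k` to a jet of order `J ≤ k`. -/
def truncJet (n J k : ℕ) (h : J ≤ k) (z : Jet n k) : Jet n J :=
  (z.1, fun r t => z.2 ⟨(r : ℕ), lt_of_lt_of_le r.isLt (Nat.succ_le_succ h)⟩ t)

/-- The total divergence of a family `F^λ` of functions of jet variables of
order `≤ J`:  the `(J+1)`-th order Lagrangian
`L₀ = Σ_λ [∂F^λ/∂x^λ + Σ_{m=0}^{J} Σ_{μ₁…μ_m} (∂F^λ/∂u_{μ₁…μ_m}) u_{μ₁…μ_m λ}]`. -/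
def totalDiv (n J : ℕ) (F : Fin n → Jet n J → ℝ) (z : Jet n (J + 1)) : ℝ :=
  ∑ lam : Fin n,
    (fderiv ℝ (F lam) (truncJet n J (J + 1) (Nat.le_succ J) z) (Pi.single lam 1, 0)
      + ∑ m : Fin (J + 1), ∑ t : Fin (m : ℕ) → Fin n,
          dLdu n J (F lam) m t (truncJet n J (J + 1) (Nat.le_succ J) z)
            * z.2 ⟨(m : ℕ) + 1, Nat.succ_lt_succ m.isLt⟩ (Fin.snoc t lam))

/-- The iterated derivative of a smooth function is invariant under a transposition of two
adjacent arguments. -/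
theorem IsCInf.iteratedFDeriv_comp_adjacent_swap {E G : Type*} [NormedAddCommGroup E]
    [NormedSpace ℝ E] [NormedAddCommGroup G] [NormedSpace ℝ G] {f : E → G} (hf : IsCInf f)
    {m : ℕ} (i : Fin m) (x : E) (v : Fin (m + 1) → E) :
    iteratedFDeriv ℝ (m + 1) f x (v ∘ Equiv.swap i.castSucc i.succ)
      = iteratedFDeriv ℝ (m + 1) f x v := by
  induction m generalizing x with
  | zero => exact i.elim0
  | succ m ih =>
    refine Fin.cases ?_ (fun j => ?_) i
    · have hsymm : IsSymmSndFDerivAt ℝ (iteratedFDeriv ℝ m f) x :=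
        ContDiffAt.isSymmSndFDerivAt (n := 2)
          ((hf (2 + m)).contDiffAt.iteratedFDeriv_right (by norm_cast)) (by simp)
      have hd : ∀ w : Fin (m + 2) → E, iteratedFDeriv ℝ (m + 2) f x w
          = fderiv ℝ (fderiv ℝ (iteratedFDeriv ℝ m f)) x (w 0) (w 1) (Fin.tail (Fin.tail w)) := by
        intro w
        rw [iteratedFDeriv_succ_apply_left,
          ← fderiv_continuousMultilinear_apply_const_apply
            ((hf (m + 2)).differentiable_iteratedFDeriv (by norm_cast; omega) x)]
        simp only [iteratedFDeriv_succ_apply_left]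
        have h1 : DifferentiableAt ℝ (fderiv ℝ (iteratedFDeriv ℝ m f)) x :=
          (((hf (2 + m)).iteratedFDeriv_right (m := 2) (by norm_cast)).fderiv_right
            (m := 1) (by norm_num)).differentiable (by norm_num) x
        rw [fderiv_continuousMultilinear_apply_const_apply (by fun_prop),
          fderiv_clm_apply h1 (by fun_prop)]
        simp [Fin.tail]
      rw [hd, hd, hsymm.eq]
      congr 1
    · rw [iteratedFDeriv_succ_apply_left, iteratedFDeriv_succ_apply_left]
      have hd := (hf (m + 2)).differentiable_iteratedFDeriv (m := m + 1) (by norm_cast; omega) x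
      have h0 : (v ∘ Equiv.swap j.succ.castSucc j.succ.succ) 0 = v 0 := by
        simp only [Function.comp_apply]
        rw [Equiv.swap_apply_of_ne_of_ne] <;> simp [Fin.ext_iff]
      have ht : Fin.tail (v ∘ Equiv.swap j.succ.castSucc j.succ.succ)
          = Fin.tail v ∘ Equiv.swap j.castSucc j.succ := by
        ext k
        simp only [Fin.tail, Function.comp_apply, ← Fin.succ_castSucc]
        rw [(Fin.succ_injective _).swap_apply]
      rw [h0, ht, ← fderiv_continuousMultilinear_apply_const_apply hd,
        ← fderiv_continuousMultilinear_apply_const_apply hd]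
      simp only [ih]

/-- The iterated derivative of a smooth function is symmetric. -/
theorem IsCInf.iteratedFDeriv_comp_perm {E G : Type*} [NormedAddCommGroup E]
    [NormedSpace ℝ E] [NormedAddCommGroup G] [NormedSpace ℝ G] {f : E → G} (hf : IsCInf f)
    {m : ℕ} (σ : Equiv.Perm (Fin m)) (x : E) (v : Fin m → E) :
    iteratedFDeriv ℝ m f x (v ∘ σ) = iteratedFDeriv ℝ m f x v := by
  cases m with
  | zero => exact congrArg _ (Subsingleton.elim _ _)
  | succ m =>
    have hσ : σ ∈ Submonoid.closure
        (Set.range fun i : Fin m => Equiv.swap i.castSucc i.succ) := by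
      rw [Equiv.Perm.mclosure_swap_castSucc_succ]; trivial
    induction hσ using Submonoid.closure_induction generalizing v with
    | mem τ hτ =>
      obtain ⟨i, rfl⟩ := hτ
      exact hf.iteratedFDeriv_comp_adjacent_swap i x v
    | one => simp
    | mul τ₁ τ₂ _ _ h₁ h₂ =>
      rw [Equiv.Perm.coe_mul, ← Function.comp_assoc, h₂, h₁]

theorem pderivIter_comp_perm {n m : ℕ} {φ : Vec n → ℝ} (hφ : IsCInf φ)
    (σ : Equiv.Perm (Fin m)) (t : Fin m → Fin n) (x : Vec n) :
    pderivIter n m (t ∘ σ) φ x = pderivIter n m t φ x :=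
  hφ.iteratedFDeriv_comp_perm σ x fun i => Pi.single (t i) 1

/-- Permuting all but the last index. -/
theorem pderivIter_snoc_comp_perm {n m : ℕ} {φ : Vec n → ℝ} (hφ : IsCInf φ)
    (σ : Equiv.Perm (Fin m)) (t : Fin m → Fin n) (lam : Fin n) (x : Vec n) :
    pderivIter n (m + 1) (Fin.snoc (t ∘ σ) lam) φ x
      = pderivIter n (m + 1) (Fin.snoc t lam) φ x := by
  have h : (Fin.snoc (t ∘ σ) lam : Fin (m + 1) → Fin n)
      = (Fin.snoc t lam : Fin (m + 1) → Fin n) ∘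
        (finSuccEquivLast.permCongr.symm (Equiv.optionCongr σ)) := by
    ext i
    refine Fin.lastCases ?_ (fun j => ?_) i <;> simp [Equiv.permCongr, Equiv.equivCongr]
  rw [h, pderivIter_comp_perm hφ]

theorem pderivIter_snoc {n m : ℕ} {φ : Vec n → ℝ} (hφ : IsCInf φ)
    (t : Fin m → Fin n) (lam : Fin n) (x : Vec n) :
    pderivIter n (m + 1) (Fin.snoc t lam) φ x
      = fderiv ℝ (pderivIter n m t φ) x (Pi.single lam 1) := by
  have h : pderivIter n (m + 1) (Fin.snoc t lam) φ x
      = pderivIter n (m + 1) (Fin.cons lam t) φ x := by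
    rw [← pderivIter_comp_perm hφ (finRotate (m + 1)) (Fin.cons lam t)]
    congr 1
    ext i
    refine Fin.lastCases ?_ (fun j => ?_) i
    · simp
    · simp [finRotate_apply]
  rw [h, pderivIter, iteratedFDeriv_succ_apply_left,
    ← fderiv_continuousMultilinear_apply_const_apply
      ((hφ (m + 1)).differentiable_iteratedFDeriv (by norm_cast; omega) x)]
  rfl

theorem differentiable_pderivIter {n m : ℕ} {φ : Vec n → ℝ} (hφ : IsCInf φ)
    (t : Fin m → Fin n) : Differentiable ℝ (pderivIter n m t φ) := by
  have h := (hφ (m + 1)).differentiable_iteratedFDeriv (m := m) (by norm_cast; omega)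
  unfold pderivIter
  fun_prop

/-- The coordinate vector of the jet variable `u_w` of rank `r`. -/
def jetBasis (n k : ℕ) (r : Fin (k + 1)) (w : Fin (r : ℕ) → Fin n) : Jet n k :=
  (0, Pi.single r (Pi.single w 1))

theorem jetBasis_same {n k : ℕ} (r : Fin (k + 1)) (w t : Fin (r : ℕ) → Fin n) :
    (jetBasis n k r w).2 r t = if t = w then 1 else 0 := by
  simp [jetBasis, Pi.single_apply]

theorem jetBasis_of_ne {n k : ℕ} {r q : Fin (k + 1)} (h : q ≠ r) (w : Fin (r : ℕ) → Fin n)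
    (t : Fin (q : ℕ) → Fin n) : (jetBasis n k r w).2 q t = 0 := by
  simp [jetBasis, h]

theorem dLdu_eq {n k : ℕ} (L : Jet n k → ℝ) (r : Fin (k + 1)) (t : Fin (r : ℕ) → Fin n)
    (z : Jet n k) :
    dLdu n k L r t z = ((r : ℕ).factorial : ℝ)⁻¹ *
      ∑ σ : Equiv.Perm (Fin (r : ℕ)), fderiv ℝ L z (jetBasis n k r (t ∘ σ)) := rfl

theorem jet_eq_sum {n k : ℕ} (z : Jet n k) :
    z = (z.1, 0) + ∑ r : Fin (k + 1), ∑ t : Fin (r : ℕ) → Fin n,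
      z.2 r t • jetBasis n k r t := by
  refine Prod.ext ?_ ?_
  · simp [Prod.fst_sum, jetBasis]
  · ext q w
    simp only [Prod.snd_add, Prod.snd_sum, zero_add, Prod.smul_snd, Finset.sum_apply,
      Pi.smul_apply, smul_eq_mul]
    rw [Finset.sum_eq_single q]
    · simp [jetBasis_same]
    · intro r _ hr
      simp [jetBasis_of_ne hr.symm]
    · simp

/-- Truncation of jets as a continuous linear map. -/
def truncJetL (n J k : ℕ) (h : J ≤ k) : Jet n k →L[ℝ] Jet n J :=
  LinearMap.toContinuousLinearMap
    { toFun := truncJet n J k h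
      map_add' := fun _ _ => rfl
      map_smul' := fun _ _ => rfl }

theorem fderiv_comp_truncJet {n J k : ℕ} (h : J ≤ k) {E : Type*} [NormedAddCommGroup E]
    [NormedSpace ℝ E] {G : Jet n J → E} (hG : Differentiable ℝ G) (z v : Jet n k) :
    fderiv ℝ (fun y => G (truncJet n J k h y)) z v
      = fderiv ℝ G (truncJet n J k h z) (truncJet n J k h v) := by
  have := ((hG (truncJetL n J k h z)).hasFDerivAt.comp z (truncJetL n J k h).hasFDerivAt).fderiv
  exact congrArg (fun A => A v) this

theorem truncJet_jetBasis_of_le {n J k : ℕ} (h : J ≤ k) {r : ℕ} (hr : r < J + 1)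
    (w : Fin r → Fin n) :
    truncJet n J k h (jetBasis n k ⟨r, by omega⟩ w) = jetBasis n J ⟨r, hr⟩ w := by
  refine Prod.ext rfl ?_
  ext q t
  change (jetBasis n k ⟨r, _⟩ w).2 ⟨q, _⟩ t = _
  obtain ⟨q, hq⟩ := q
  by_cases hqr : q = r
  · subst hqr
    exact (jetBasis_same (k := k) ⟨q, _⟩ w t).trans (jetBasis_same (k := J) ⟨q, _⟩ w t).symm
  · rw [jetBasis_of_ne (by simpa using hqr), jetBasis_of_ne (by simpa using hqr)]

theorem truncJet_jetBasis_of_lt {n J k : ℕ} (h : J ≤ k) {r : Fin (k + 1)} (hr : J < (r : ℕ))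
    (w : Fin (r : ℕ) → Fin n) :
    truncJet n J k h (jetBasis n k r w) = 0 := by
  refine Prod.ext rfl ?_
  ext q t
  refine jetBasis_of_ne (q := ⟨q, by omega⟩) (fun hq => ?_) w t
  have := congrArg Fin.val hq
  simp only at this
  omega

theorem dLdu_comp_truncJet_of_le {n J k : ℕ} (h : J ≤ k) {G : Jet n J → ℝ}
    (hG : Differentiable ℝ G) {r : ℕ} (hr : r < J + 1) (t : Fin r → Fin n) (z : Jet n k) :
    dLdu n k (fun y => G (truncJet n J k h y)) ⟨r, by omega⟩ t z
      = dLdu n J G ⟨r, hr⟩ t (truncJet n J k h z) := by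
  simp only [dLdu_eq, fderiv_comp_truncJet h hG]
  congr 1
  exact Finset.sum_congr rfl fun σ _ =>
    congrArg _ (truncJet_jetBasis_of_le h hr (t ∘ σ))

theorem dLdu_comp_truncJet_of_lt {n J k : ℕ} (h : J ≤ k) {G : Jet n J → ℝ}
    (hG : Differentiable ℝ G) {r : Fin (k + 1)} (hr : J < (r : ℕ)) (t : Fin (r : ℕ) → Fin n)
    (z : Jet n k) :
    dLdu n k (fun y => G (truncJet n J k h y)) r t z = 0 := by
  simp [dLdu_eq, fderiv_comp_truncJet h hG, truncJet_jetBasis_of_lt h hr]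

theorem dLdu_add {n k : ℕ} {L M : Jet n k → ℝ} (hL : Differentiable ℝ L)
    (hM : Differentiable ℝ M) (r : Fin (k + 1)) (t : Fin (r : ℕ) → Fin n) (z : Jet n k) :
    dLdu n k (fun y => L y + M y) r t z = dLdu n k L r t z + dLdu n k M r t z := by
  simp only [dLdu_eq, fderiv_fun_add (hL z) (hM z), add_apply,
    Finset.sum_add_distrib, mul_add]

theorem IsCInf.differentiable {E G : Type*} [NormedAddCommGroup E] [NormedSpace ℝ E]
    [NormedAddCommGroup G] [NormedSpace ℝ G] {f : E → G} (hf : IsCInf f) :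
    Differentiable ℝ f :=
  (hf 1).differentiable (by norm_num)

theorem IsCInf.differentiable_fderiv {E G : Type*} [NormedAddCommGroup E] [NormedSpace ℝ E]
    [NormedAddCommGroup G] [NormedSpace ℝ G] {f : E → G} (hf : IsCInf f) :
    Differentiable ℝ (fderiv ℝ f) :=
  ((hf 2).fderiv_right (m := 1) (by norm_num)).differentiable (by norm_num)

theorem IsCInf.isSymmSndFDerivAt {E G : Type*} [NormedAddCommGroup E] [NormedSpace ℝ E]
    [NormedAddCommGroup G] [NormedSpace ℝ G] {f : E → G} (hf : IsCInf f) (x : E) :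
    IsSymmSndFDerivAt ℝ f x :=
  ((hf 2).contDiffAt).isSymmSndFDerivAt (by simp)

/-- The partial derivative in direction `lam` of the `k`-jet prolongation of `φ`. -/
def jetDeriv (n k : ℕ) (φ : Vec n → ℝ) (lam : Fin n) (x : Vec n) : Jet n k :=
  (Pi.single lam 1, fun r t => pderivIter n ((r : ℕ) + 1) (Fin.snoc t lam) φ x)

theorem differentiable_jetEv {n : ℕ} (k : ℕ) {φ : Vec n → ℝ} (hφ : IsCInf φ) :
    Differentiable ℝ (jetEv n k φ) :=
  differentiable_id.prodMk <| differentiable_pi.2 fun _ => differentiable_pi.2 fun t =>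
    differentiable_pderivIter hφ t

theorem fderiv_jetEv {n k : ℕ} {φ : Vec n → ℝ} (hφ : IsCInf φ) (lam : Fin n) (x : Vec n) :
    fderiv ℝ (jetEv n k φ) x (Pi.single lam 1) = jetDeriv n k φ lam x := by
  have h : HasFDerivAt (jetEv n k φ) ((ContinuousLinearMap.id ℝ (Vec n)).prod
      (ContinuousLinearMap.pi fun r => ContinuousLinearMap.pi fun t =>
        fderiv ℝ (pderivIter n (r : ℕ) t φ) x)) x :=
    (hasFDerivAt_id x).prodMk <| hasFDerivAt_pi.2 fun _ => hasFDerivAt_pi.2 fun t =>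
      (differentiable_pderivIter hφ t x).hasFDerivAt
  rw [h.fderiv]
  refine Prod.ext rfl ?_
  ext r t
  exact (pderivIter_snoc hφ t lam x).symm

theorem hasFDerivAt_dLdu {n k : ℕ} {F : Jet n k → ℝ} (hF : IsCInf F) (r : Fin (k + 1))
    (t : Fin (r : ℕ) → Fin n) (z : Jet n k) :
    HasFDerivAt (dLdu n k F r t) (((r : ℕ).factorial : ℝ)⁻¹ •
      ∑ σ : Equiv.Perm (Fin (r : ℕ)),
        (fderiv ℝ (fderiv ℝ F) z).flip (jetBasis n k r (t ∘ σ))) z := by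
  refine HasFDerivAt.const_mul (HasFDerivAt.fun_sum fun σ _ => ?_) _
  have h := (hF.differentiable_fderiv z).hasFDerivAt.clm_apply
    (hasFDerivAt_const (jetBasis n k r (t ∘ σ)) z)
  rw [ContinuousLinearMap.comp_zero, zero_add] at h
  exact h

theorem differentiable_dLdu {n k : ℕ} {F : Jet n k → ℝ} (hF : IsCInf F) (r : Fin (k + 1))
    (t : Fin (r : ℕ) → Fin n) : Differentiable ℝ (dLdu n k F r t) :=
  fun z => (hasFDerivAt_dLdu hF r t z).differentiableAt

theorem fderiv_dLdu {n k : ℕ} {F : Jet n k → ℝ} (hF : IsCInf F) (r : Fin (k + 1))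
    (t : Fin (r : ℕ) → Fin n) (z v : Jet n k) :
    fderiv ℝ (dLdu n k F r t) z v = ((r : ℕ).factorial : ℝ)⁻¹ *
      ∑ σ : Equiv.Perm (Fin (r : ℕ)),
        fderiv ℝ (fderiv ℝ F) z v (jetBasis n k r (t ∘ σ)) := by
  rw [(hasFDerivAt_dLdu hF r t z).fderiv]
  simp

theorem pderiv1_dLdu_jetEv {n k : ℕ} {F : Jet n k → ℝ} (hF : IsCInf F) {φ : Vec n → ℝ}
    (hφ : IsCInf φ) (r : Fin (k + 1)) (t : Fin (r : ℕ) → Fin n) (lam : Fin n) (x : Vec n) :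
    pderiv1 n lam (fun y => dLdu n k F r t (jetEv n k φ y)) x
      = ((r : ℕ).factorial : ℝ)⁻¹ * ∑ σ : Equiv.Perm (Fin (r : ℕ)),
        fderiv ℝ (fderiv ℝ F) (jetEv n k φ x) (jetBasis n k r (t ∘ σ))
          (jetDeriv n k φ lam x) := by
  have h := fderiv_comp (g := dLdu n k F r t) x (differentiable_dLdu hF r t _)
    (differentiable_jetEv k hφ x)
  rw [pderiv1, show (fun y => dLdu n k F r t (jetEv n k φ y))
    = dLdu n k F r t ∘ jetEv n k φ from rfl, h, ContinuousLinearMap.comp_apply,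
    fderiv_jetEv hφ, fderiv_dLdu hF]
  simp only [(hF.isSymmSndFDerivAt _).eq (jetDeriv n k φ lam x)]

/-- Contracting a symmetrized array with a symmetric one. -/
theorem sum_symmetrize_mul {n m : ℕ} (a u : (Fin m → Fin n) → ℝ)
    (hu : ∀ (σ : Equiv.Perm (Fin m)) t, u (t ∘ σ) = u t) :
    ∑ t, ((m.factorial : ℝ)⁻¹ * ∑ σ : Equiv.Perm (Fin m), a (t ∘ σ)) * u t
      = ∑ t, a t * u t := by
  have h : ∀ σ : Equiv.Perm (Fin m), ∑ t, a (t ∘ σ) * u t = ∑ t, a t * u t := fun σ => by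
    rw [← (σ.symm.arrowCongr (Equiv.refl (Fin n))).sum_comp fun t => a t * u t]
    exact Finset.sum_congr rfl fun t _ => congrArg (a (t ∘ σ) * ·) (hu σ t).symm
  simp only [mul_assoc, Finset.sum_mul, ← Finset.mul_sum]
  rw [Finset.sum_comm]
  simp only [h, Finset.sum_const, Finset.card_univ, Fintype.card_perm, Fintype.card_fin,
    nsmul_eq_mul]
  rw [← mul_assoc, inv_mul_cancel₀ (by positivity), one_mul]

theorem truncJet_jetEv {n J k : ℕ} (h : J ≤ k) (φ : Vec n → ℝ) (x : Vec n) :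
    truncJet n J k h (jetEv n k φ x) = jetEv n J φ x := rfl

theorem hasFDerivAt_totalDiv {n J : ℕ} {F : Fin n → Jet n J → ℝ} (hF : ∀ lam, IsCInf (F lam))
    (z : Jet n (J + 1)) :
    HasFDerivAt (totalDiv n J F) (∑ lam : Fin n,
      (fderiv ℝ (fun y => fderiv ℝ (F lam) (truncJet n J (J + 1) J.le_succ y)
          (Pi.single lam 1, 0)) z
        + ∑ m : Fin (J + 1), ∑ t : Fin (m : ℕ) → Fin n,
          (dLdu n J (F lam) m t (truncJet n J (J + 1) J.le_succ z) •
            fderiv ℝ (fun y : Jet n (J + 1) => y.2 m.succ (Fin.snoc t lam)) z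
          + z.2 m.succ (Fin.snoc t lam) •
            fderiv ℝ (fun y => dLdu n J (F lam) m t (truncJet n J (J + 1) J.le_succ y)) z))) z := by
  have hT : Differentiable ℝ (truncJet n J (J + 1) J.le_succ) :=
    (truncJetL n J (J + 1) J.le_succ).differentiable
  refine HasFDerivAt.fun_sum fun lam _ => HasFDerivAt.fun_add (DifferentiableAt.hasFDerivAt ?_) <|
    HasFDerivAt.fun_sum fun m _ => HasFDerivAt.fun_sum fun t _ =>
      HasFDerivAt.mul (DifferentiableAt.hasFDerivAt ?_) (DifferentiableAt.hasFDerivAt ?_)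
  · exact (((hF lam).differentiable_fderiv.comp hT) z).clm_apply (differentiableAt_const _)
  · exact ((differentiable_dLdu (hF lam) m t).comp hT) z
  · fun_prop

theorem differentiable_totalDiv {n J : ℕ} {F : Fin n → Jet n J → ℝ}
    (hF : ∀ lam, IsCInf (F lam)) : Differentiable ℝ (totalDiv n J F) :=
  fun z => (hasFDerivAt_totalDiv hF z).differentiableAt

/-- The differential of a total divergence along the jet of a function. -/
theorem fderiv_totalDiv_jetEv {n J : ℕ} {F : Fin n → Jet n J → ℝ}
    (hF : ∀ lam, IsCInf (F lam)) {φ : Vec n → ℝ} (hφ : IsCInf φ) (x : Vec n)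
    (v : Jet n (J + 1)) :
    fderiv ℝ (totalDiv n J F) (jetEv n (J + 1) φ x) v = ∑ lam : Fin n,
      (fderiv ℝ (fderiv ℝ (F lam)) (jetEv n J φ x) (truncJet n J (J + 1) J.le_succ v)
          (jetDeriv n J φ lam x)
        + ∑ m : Fin (J + 1), ∑ t : Fin (m : ℕ) → Fin n,
          dLdu n J (F lam) m t (jetEv n J φ x) * v.2 m.succ (Fin.snoc t lam)) := by
  rw [(hasFDerivAt_totalDiv hF _).fderiv]
  simp only [sum_apply, add_apply,
    smul_apply, smul_eq_mul]
  refine Finset.sum_congr rfl fun lam _ => ?_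
  have hcoord : ∀ (m : Fin (J + 1)) (s : Fin (m.succ : ℕ) → Fin n),
      fderiv ℝ (fun y : Jet n (J + 1) => y.2 m.succ s) (jetEv n (J + 1) φ x) v
        = v.2 m.succ s := fun m s => by
    have h := ((ContinuousLinearMap.proj (R := ℝ) s).comp
      ((ContinuousLinearMap.proj (R := ℝ) m.succ).comp
        (ContinuousLinearMap.snd ℝ (Vec n) (JetU n (J + 1))))).hasFDerivAt
          (x := jetEv n (J + 1) φ x)
    exact congrArg (fun A => A v) h.fderiv
  have hfst : fderiv ℝ (fun y => fderiv ℝ (F lam) (truncJet n J (J + 1) J.le_succ y)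
      (Pi.single lam 1, 0)) (jetEv n (J + 1) φ x) v
      = fderiv ℝ (fderiv ℝ (F lam)) (jetEv n J φ x) (truncJet n J (J + 1) J.le_succ v)
          (Pi.single lam 1, 0) := by
    have hd := (hF lam).differentiable_fderiv
    rw [fderiv_comp_truncJet J.le_succ
      (G := fun y => fderiv ℝ (F lam) y (Pi.single lam 1, 0)) (by fun_prop),
      fderiv_clm_apply (hd _) (by fun_prop), truncJet_jetEv]
    simp
  rw [hfst]
  simp only [hcoord, fderiv_comp_truncJet J.le_succ (differentiable_dLdu (hF lam) _ _),
    fderiv_dLdu (hF lam), truncJet_jetEv, Finset.sum_add_distrib]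
  set w := truncJet n J (J + 1) J.le_succ v
  have hsecond : ∑ m : Fin (J + 1), ∑ t : Fin (m : ℕ) → Fin n,
      (jetEv n (J + 1) φ x).2 m.succ (Fin.snoc t lam) * (((m : ℕ).factorial : ℝ)⁻¹ *
        ∑ σ : Equiv.Perm (Fin (m : ℕ)),
          fderiv ℝ (fderiv ℝ (F lam)) (jetEv n J φ x) w (jetBasis n J m (t ∘ σ)))
      = ∑ m : Fin (J + 1), ∑ t : Fin (m : ℕ) → Fin n,
        (jetDeriv n J φ lam x).2 m t *
          fderiv ℝ (fderiv ℝ (F lam)) (jetEv n J φ x) w (jetBasis n J m t) := by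
    refine Finset.sum_congr rfl fun m _ => ?_
    have h := sum_symmetrize_mul
      (fun t => fderiv ℝ (fderiv ℝ (F lam)) (jetEv n J φ x) w (jetBasis n J m t))
      (fun t => (jetDeriv n J φ lam x).2 m t)
      (fun σ t => pderivIter_snoc_comp_perm hφ σ t lam x)
    simp only [mul_comm _ ((jetDeriv n J φ lam x).2 m _)] at h
    exact h
  rw [hsecond]
  conv_rhs => rw [jet_eq_sum (jetDeriv n J φ lam x)]
  simp only [map_add, map_sum, map_smul, smul_eq_mul]
  rw [show (jetDeriv n J φ lam x).1 = Pi.single lam 1 from rfl]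
  ring

/-- The symmetrized derivatives of a total divergence along the jet of a function. -/
theorem dLdu_totalDiv_jetEv {n J : ℕ} {F : Fin n → Jet n J → ℝ}
    (hF : ∀ lam, IsCInf (F lam)) {φ : Vec n → ℝ} (hφ : IsCInf φ) (x : Vec n)
    (r : Fin (J + 2)) (s : Fin (r : ℕ) → Fin n) :
    dLdu n (J + 1) (totalDiv n J F) r s (jetEv n (J + 1) φ x)
      = (if h : (r : ℕ) < J + 1 then
          ∑ lam : Fin n, pderiv1 n lam
            (fun y => dLdu n J (F lam) ⟨(r : ℕ), h⟩ s (jetEv n J φ y)) x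
        else 0)
        + ((r : ℕ).factorial : ℝ)⁻¹ * ∑ σ : Equiv.Perm (Fin (r : ℕ)), ∑ lam : Fin n,
          ∑ m : Fin (J + 1), ∑ t : Fin (m : ℕ) → Fin n,
            dLdu n J (F lam) m t (jetEv n J φ x)
              * (jetBasis n (J + 1) r (s ∘ σ)).2 m.succ (Fin.snoc t lam) := by
  simp only [dLdu_eq (totalDiv n J F), fderiv_totalDiv_jetEv hF hφ, Finset.sum_add_distrib,
    mul_add]
  congr 1
  split_ifs with h
  · simp only [pderiv1_dLdu_jetEv (hF _) hφ]
    rw [Finset.sum_comm, Finset.mul_sum]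
    refine Finset.sum_congr rfl fun lam _ => ?_
    congr 1
    refine Finset.sum_congr rfl fun σ _ => ?_
    rw [← truncJet_jetBasis_of_le J.le_succ h]
  · simp [truncJet_jetBasis_of_lt J.le_succ (r := r) (by omega)]

theorem dLdu_totalDiv_jetEv_zero {n J : ℕ} {F : Fin n → Jet n J → ℝ}
    (hF : ∀ lam, IsCInf (F lam)) {φ : Vec n → ℝ} (hφ : IsCInf φ) (x : Vec n)
    (s : Fin 0 → Fin n) :
    dLdu n (J + 1) (totalDiv n J F) ⟨0, by omega⟩ s (jetEv n (J + 1) φ x)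
      = ∑ lam : Fin n, pderiv1 n lam
          (fun y => dLdu n J (F lam) ⟨0, J.succ_pos⟩ s (jetEv n J φ y)) x := by
  rw [dLdu_totalDiv_jetEv hF hφ, dif_pos J.succ_pos, add_eq_left]
  refine mul_eq_zero_of_right _ <| Finset.sum_eq_zero fun σ _ => Finset.sum_eq_zero fun lam _ =>
    Finset.sum_eq_zero fun m _ => Finset.sum_eq_zero fun t _ => mul_eq_zero_of_right _ ?_
  exact jetBasis_of_ne (Fin.succ_ne_zero m) _ _

theorem dLdu_totalDiv_jetEv_succ {n J : ℕ} {F : Fin n → Jet n J → ℝ}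
    (hF : ∀ lam, IsCInf (F lam)) {φ : Vec n → ℝ} (hφ : IsCInf φ) (x : Vec n)
    (l : ℕ) (hl : l < J + 1) (s : Fin (l + 1) → Fin n) :
    dLdu n (J + 1) (totalDiv n J F) ⟨l + 1, by omega⟩ s (jetEv n (J + 1) φ x)
      = (if h : l + 1 < J + 1 then
          ∑ lam : Fin n, pderiv1 n lam
            (fun y => dLdu n J (F lam) ⟨l + 1, h⟩ s (jetEv n J φ y)) x
        else 0)
        + symComb n l (fun t lam => dLdu n J (F lam) ⟨l, hl⟩ t (jetEv n J φ x)) s := by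
  rw [dLdu_totalDiv_jetEv hF hφ]
  congr 1
  refine congrArg _ (Finset.sum_congr rfl fun σ _ => ?_)
  have hsnoc : ∀ (t : Fin l → Fin n) (lam : Fin n),
      (jetBasis n (J + 1) ⟨l + 1, by omega⟩ (s ∘ σ)).2 ⟨l + 1, by omega⟩ (Fin.snoc t lam)
        = if lam = s (σ (Fin.last l)) then
            (if t = fun i => s (σ (Fin.castSucc i)) then 1 else 0) else 0 := fun t lam => by
    rw [jetBasis_same, ← ite_and]
    refine if_congr ?_ rfl rfl
    conv_lhs => rw [← Fin.snoc_init_self (α := fun _ => Fin n) (s ∘ σ)]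
    rw [Fin.snoc_inj, and_comm]
    rfl
  have hm : ∀ lam : Fin n, ∑ m : Fin (J + 1), ∑ t : Fin (m : ℕ) → Fin n,
      dLdu n J (F lam) m t (jetEv n J φ x)
        * (jetBasis n (J + 1) ⟨l + 1, by omega⟩ (s ∘ σ)).2 m.succ (Fin.snoc t lam)
      = ∑ t : Fin l → Fin n, dLdu n J (F lam) ⟨l, hl⟩ t (jetEv n J φ x)
        * (jetBasis n (J + 1) ⟨l + 1, by omega⟩ (s ∘ σ)).2 ⟨l + 1, by omega⟩
          (Fin.snoc t lam) := fun lam => by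
    refine Finset.sum_eq_single (⟨l, hl⟩ : Fin (J + 1)) (fun m _ hne => ?_) (by simp)
    refine Finset.sum_eq_zero fun t _ => mul_eq_zero_of_right _ (jetBasis_of_ne ?_ _ _)
    simpa [Fin.ext_iff] using hne
  simp only [hm, hsnoc]
  simp

/-- adding a total divergence shifts the momenta.
Let `L` be a smooth `k`-th order Lagrangian (`k = K+1`), `1 ≤ l ≤ k`
(`l = J+1`, so `J ≤ K`), `F^λ` smooth functions of jet variables of order
`≤ l−1`, and `L̃ := L + dF` (the total divergence of `F` viewed as a `k`-th
order Lagrangian).  Then `(φ, p)` satisfies the canonical first-order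
Euler–Lagrange system of `L` iff `(φ, p̃)` satisfies that of `L̃`, where
`p̃^{μ₁…μ_m λ} := p^{μ₁…μ_m λ} + (∂F^λ/∂u_{μ₁…μ_m})∘((l−1)-jet of φ)` for
`0 ≤ m ≤ l−1` and `p̃ = p` in the remaining ranks. -/
theorem statement_10 (n K J : ℕ) (hn : 1 ≤ n) (hJK : J ≤ K)
    (L : Jet n (K + 1) → ℝ) (hL : IsCInf L)
    (F : Fin n → Jet n J → ℝ) (hF : ∀ lam, IsCInf (F lam))
    (φ : Vec n → ℝ) (hφ : IsCInf φ)
    (p : Mom n (K + 1)) (hp : MomSmooth n (K + 1) p) :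
    CanonSys n K L φ p
    ↔ CanonSys n K
        (fun z => L z + totalDiv n J F (truncJet n (J + 1) (K + 1) (by omega) z))
        φ
        (fun m t lam x =>
          p m t lam x
            + if h : (m : ℕ) < J + 1 then
                dLdu n J (F lam) ⟨(m : ℕ), h⟩ t (jetEv n J φ x)
              else 0) := by
  have hTD := differentiable_totalDiv hF
  have hT : Differentiable ℝ
      (fun z => totalDiv n J F (truncJet n (J + 1) (K + 1) (by omega) z)) :=
    hTD.comp (truncJetL n (J + 1) (K + 1) (by omega)).differentiable
  have hpd : ∀ (m : Fin (K + 1)) (t : Fin (m : ℕ) → Fin n) (x : Vec n),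
      ∑ lam : Fin n, pderiv1 n lam (fun y => p m t lam y
          + if h : (m : ℕ) < J + 1 then
              dLdu n J (F lam) ⟨(m : ℕ), h⟩ t (jetEv n J φ y)
            else 0) x
        = ∑ lam : Fin n, pderiv1 n lam (p m t lam) x
          + if h : (m : ℕ) < J + 1 then
              ∑ lam : Fin n, pderiv1 n lam
                (fun y => dLdu n J (F lam) ⟨(m : ℕ), h⟩ t (jetEv n J φ y)) x
            else 0 := by
    intro m t x
    split_ifs with h
    · rw [← Finset.sum_add_distrib]
      refine Finset.sum_congr rfl fun lam _ => ?_
      simp only [pderiv1]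
      have hd : Differentiable ℝ (fun y => dLdu n J (F lam) ⟨(m : ℕ), h⟩ t (jetEv n J φ y)) :=
        (differentiable_dLdu (hF lam) ⟨(m : ℕ), h⟩ t).comp (differentiable_jetEv J hφ)
      rw [fderiv_fun_add ((hp m t lam).differentiable x) (hd x)]
      rfl
    · simp
  refine and_congr (forall_congr' fun x => ?_)
    (forall_congr' fun l => forall_congr' fun s => forall_congr' fun x => ?_)
  · rw [dLdu_add hL.differentiable hT, hpd,
      dLdu_comp_truncJet_of_le (by omega) hTD (by omega), truncJet_jetEv,
      dLdu_totalDiv_jetEv_zero hF hφ, dif_pos J.succ_pos, add_sub_add_right_eq_sub]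
  · have hsym : symComb n (l : ℕ) (fun t lam => p l t lam x
          + if h : (l : ℕ) < J + 1 then
              dLdu n J (F lam) ⟨(l : ℕ), h⟩ t (jetEv n J φ x)
            else 0) s
        = symComb n (l : ℕ) (fun t lam => p l t lam x) s
          + if h : (l : ℕ) < J + 1 then
              symComb n (l : ℕ)
                (fun t lam => dLdu n J (F lam) ⟨(l : ℕ), h⟩ t (jetEv n J φ x)) s
            else 0 := by
      split_ifs with h
      · simp only [symComb, Finset.sum_add_distrib, mul_add]
      · simp
    rw [hsym, dLdu_add hL.differentiable hT]
    simp only [hpd ⟨(l : ℕ) + 1, _⟩]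
    by_cases hl : (l : ℕ) < J + 1
    · rw [dLdu_comp_truncJet_of_le (by omega) hTD (by omega), truncJet_jetEv,
        dLdu_totalDiv_jetEv_succ hF hφ x l hl, dif_pos hl]
      by_cases hlJ : (l : ℕ) + 1 < J + 1
      · have hlK : (l : ℕ) + 1 < K + 1 := by omega
        simp only [dif_pos hlJ, dif_pos hlK]
        constructor <;> intro h <;> linarith
      · simp only [dif_neg hlJ]
        split_ifs <;> constructor <;> intro h <;> linarith
    · rw [dLdu_comp_truncJet_of_lt (by omega) hTD (by simpa using hl), dif_neg hl]
      have hlJ : ¬ (l : ℕ) + 1 < J + 1 := by omega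
      simp only [dif_neg hlJ, add_zero]
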